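/- For every n ≥ 1 and all ε > 0, C > 0, and δ > 0, there exists a smooth function H : ℝ × ℝ^{2n} → ℝ that is 1-periodic in the first variable (H(t+1,x) = H(t,x)), nonnegative, whose support in the x-variable is contained in the open ball of radius δ centered at the origin (uniformly in t), such that H(t,0) ≥ C for all t and every 1-periodic orbit γ of the time-dependent Hamiltonian flow (every solution of γ'(t) = J∇_x H(t, γ(t)) with γ(t+1) = γ(t)) has action A_H(γ) < ε. -/

import Mathlib

open scoped RealInnerProductSpace ENNReal NNReal Topology
open Metric Set

noncomputable section

/-- `ℝ^{2n}` identified with `ℂ^n`, with the standard (real) inner product and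
the standard complex structure `J` given by multiplication by `i`. -/
abbrev Esp (n : ℕ) := EuclideanSpace ℂ (Fin n)

variable {n : ℕ}

/-- The Hamiltonian vector field `X_H = J ∇H` of `H : ℝ^{2n} → ℝ`. -/
def hamVF (H : Esp n → ℝ) (x : Esp n) : Esp n := Complex.I • gradient H x

/-- A nonconstant `T`-periodic orbit of the Hamiltonian flow of `H`:
a nonconstant solution `γ` of `γ' = J∇H(γ)` with `γ (t + T) = γ t`. -/
def IsPeriodicOrbit (H : Esp n → ℝ) (γ : ℝ → Esp n) (T : ℝ) : Prop :=
  0 < T ∧ (∀ t, HasDerivAt γ (hamVF H (γ t)) t) ∧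
    (∀ t, γ (t + T) = γ t) ∧ ∃ t₀ t₁, γ t₀ ≠ γ t₁

/-- `H` has a fast (period `≤ 1`) nonconstant periodic orbit. -/
def HasFastOrbit (H : Esp n → ℝ) : Prop :=
  ∃ γ T, IsPeriodicOrbit H γ T ∧ T ≤ 1

/-- The symplectic action of a `1`-periodic loop `γ` with respect to the
(possibly time-dependent) Hamiltonian `H`:
`A_H(γ) = -(1/2)∫₀¹ ⟨Jγ(t), γ'(t)⟩ dt + ∫₀¹ H(t, γ(t)) dt`. -/
def action (H : ℝ → Esp n → ℝ) (γ : ℝ → Esp n) : ℝ :=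
  -(1 / 2) * (∫ t in (0:ℝ)..1, ⟪(Complex.I • γ t : Esp n), deriv γ t⟫) +
    ∫ t in (0:ℝ)..1, H t (γ t)

/-- The class `𝓗(V, Z)`: smooth functions on `ℝ^{2n}` with compact support
contained in `V`, constant on a neighborhood of `Z`, whose value on `Z` is the
maximum of `H`. -/
def InHclass (V Z : Set (Esp n)) (H : Esp n → ℝ) : Prop :=
  ContDiff ℝ (⊤ : ℕ∞) H ∧ IsCompact (tsupport H) ∧ tsupport H ⊆ V ∧
    (∃ U, IsOpen U ∧ Z ⊆ U ∧ ∃ c : ℝ, ∀ x ∈ U, H x = c) ∧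
    ∀ z ∈ Z, ∀ x, H x ≤ H z

/-- The relative Hofer–Zehnder capacity `c_HZ(V, Z)`: the supremum of `max H`
over all `H ∈ 𝓗(V, Z)` having no fast nonconstant periodic orbit (for `z ∈ Z`,
`H z = max H`). -/
def relCap (V Z : Set (Esp n)) : ℝ≥0∞ :=
  sSup {c | ∃ H, InHclass V Z H ∧ ¬ HasFastOrbit H ∧
    ∃ z ∈ Z, c = ENNReal.ofReal (H z)}

theorem aux_main {E : Type*} [NormedAddCommGroup E] [InnerProductSpace ℝ E]
    (β : ℝ → ℝ) (hβc : Continuous β) (h0 : ∀ t, 0 ≤ β t) (h1 : ∀ t, β t ≤ 1)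
    (X : E → E) (hX : ∀ x y, ‖X x - X y‖ ≤ (1/2) * ‖x - y‖) (y : ℝ → E)
    (hy : ∀ t ∈ Icc (0:ℝ) 1, HasDerivAt y (β t • X (y t)) t) (t : ℝ) (ht : t ∈ Icc (0:ℝ) 1) :
    (∫ s in (0:ℝ)..1, β s) / 2 * ‖X (y t)‖ ≤ ‖y 1 - y 0‖ := by
  have hXc : Continuous X := by
    have : LipschitzWith (1/2) X := LipschitzWith.of_dist_le_mul (by
      intro x y; simpa [dist_eq_norm] using hX x y)
    exact this.continuous
  have hyc : ContinuousOn y (Icc 0 1) := fun s hs => (hy s hs).continuousAt.continuousWithinAt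
  obtain ⟨a, ha, hmax⟩ := isCompact_Icc.exists_isMaxOn (⟨0, by simp⟩ : (Icc (0:ℝ) 1).Nonempty)
    (f := fun s => ‖X (y s)‖) ((hXc.comp_continuousOn hyc).norm)
  set w := X (y a) with hw
  have hM : ∀ s ∈ Icc (0:ℝ) 1, ‖X (y s)‖ ≤ ‖w‖ := fun s hs => hmax hs
  have hdist : ∀ s ∈ Icc (0:ℝ) 1, ‖y s - y a‖ ≤ ‖w‖ := by
    intro s hs
    have := (convex_Icc (0:ℝ) 1).norm_image_sub_le_of_norm_hasDerivWithin_le (f := y) (C := ‖w‖)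
      (f' := fun s => β s • X (y s)) (fun x hx => (hy x hx).hasDerivWithinAt) (fun x hx => by
        rw [norm_smul, Real.norm_of_nonneg (h0 x)]
        calc _ ≤ 1 * ‖w‖ := mul_le_mul (h1 x) (hM x hx) (norm_nonneg _) zero_le_one
          _ = _ := one_mul _) ha hs
    refine this.trans ?_
    have : ‖s - a‖ ≤ 1 := by
      rw [Real.norm_eq_abs, abs_le]; constructor <;> linarith [hs.1, hs.2, ha.1, ha.2]
    nlinarith [norm_nonneg w]
  have hin : ∀ s ∈ Icc (0:ℝ) 1, ‖w‖^2 / 2 ≤ ⟪w, X (y s)⟫ := by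
    intro s hs
    have e : ⟪w, X (y s)⟫ = ‖w‖^2 + ⟪w, X (y s) - w⟫ := by
      rw [inner_sub_right, real_inner_self_eq_norm_sq]; ring
    have b1 := abs_real_inner_le_norm w (X (y s) - w)
    have b2 : ‖X (y s) - w‖ ≤ 1/2 * ‖w‖ := (hX _ _).trans (by linarith [hdist s hs])
    have b3 := (abs_le.1 b1).1
    nlinarith [norm_nonneg w, norm_nonneg (X (y s) - w)]
  have hmono : MonotoneOn (fun s => ⟪w, y s⟫ - ‖w‖^2/2 * ∫ u in (0:ℝ)..s, β u) (Icc 0 1) := by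
    have hd : ∀ s ∈ Icc (0:ℝ) 1, HasDerivAt (fun s => ⟪w, y s⟫ - ‖w‖^2/2 * ∫ u in (0:ℝ)..s, β u)
        (⟪w, β s • X (y s)⟫ - ‖w‖^2/2 * β s) s := by
      intro s hs
      have i1 : HasDerivAt (fun s => ⟪w, y s⟫) (⟪w, β s • X (y s)⟫) s := by
        simpa using (hasDerivAt_const s w).inner ℝ (hy s hs)
      exact i1.sub ((hβc.integral_hasStrictDerivAt 0 s).hasDerivAt.const_mul _)
    apply monotoneOn_of_deriv_nonneg (convex_Icc 0 1)
    · exact fun s hs => (hd s hs).continuousAt.continuousWithinAt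
    · exact fun s hs => (hd s (interior_subset hs)).differentiableAt.differentiableWithinAt
    · intro s hs
      have hs' := interior_subset hs
      rw [(hd s hs').deriv, inner_smul_right]
      nlinarith [hin s hs', h0 s]
  have h01 := hmono (show (0:ℝ) ∈ Icc (0:ℝ) 1 by simp) (show (1:ℝ) ∈ Icc (0:ℝ) 1 by simp) zero_le_one
  simp only [intervalIntegral.integral_same, mul_zero, sub_zero] at h01
  set B := ∫ u in (0:ℝ)..1, β u
  have hB : 0 ≤ B := intervalIntegral.integral_nonneg zero_le_one (fun u _ => h0 u)
  have key : ‖w‖^2/2 * B ≤ ‖w‖ * ‖y 1 - y 0‖ := by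
    have := real_inner_le_norm w (y 1 - y 0)
    rw [inner_sub_right] at this
    linarith
  have : B / 2 * ‖w‖ ≤ ‖y 1 - y 0‖ := by
    rcases (norm_nonneg w).eq_or_lt with h | h
    · rw [← h]; simp
    · refine le_of_mul_le_mul_left ?_ h
      nlinarith
  refine le_trans ?_ this
  exact mul_le_mul_of_nonneg_left (hM t ht) (by positivity)

lemma inner_smul_conj (c : ℂ) (x y : Esp n) : ⟪c • x, y⟫ = ⟪x, (starRingEnd ℂ c) • y⟫ := by
  simp only [PiLp.inner_apply, Complex.inner]
  refine Finset.sum_congr rfl fun i _ => ?_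
  simp; ring
/-- The rotation factor `exp(-iθ)`. -/
def rotE (θ : ℝ) : ℂ := Complex.exp (-(θ * Complex.I))

lemma rotE_norm (θ : ℝ) : ‖rotE θ‖ = 1 := by
  have : rotE θ = Complex.exp (((-θ : ℝ) : ℂ) * Complex.I) := by
    unfold rotE; push_cast; ring_nf
  rw [this, Complex.norm_exp_ofReal_mul_I]

lemma rotE_mul_conj (θ : ℝ) : rotE θ * (starRingEnd ℂ (rotE θ)) = 1 := by
  rw [Complex.mul_conj, Complex.normSq_eq_norm_sq, rotE_norm]; simp

lemma rotE_zero : rotE 0 = 1 := by simp [rotE]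

lemma rotE_hasDerivAt (θ : ℝ) : HasDerivAt rotE (-(Complex.I * rotE θ)) θ := by
  have h : HasDerivAt (fun z : ℂ => Complex.exp (-(z * Complex.I)))
      (Complex.exp (-((θ:ℂ) * Complex.I)) * (-(1 * Complex.I))) (θ:ℂ) :=
    ((hasDerivAt_id (θ:ℂ)).mul_const Complex.I).neg.cexp
  have h' : HasDerivAt rotE _ θ := h.comp_ofReal
  convert h' using 1
  simp only [rotE]; ring

lemma rotE_contDiff {m : WithTop ℕ∞} : ContDiff ℝ m rotE := by
  unfold rotE
  exact Complex.contDiff_exp.comp ((Complex.ofRealCLM.contDiff.mul contDiff_const).neg)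

lemma inner_I_self (x : Esp n) : ⟪x, Complex.I • x⟫ = 0 := by
  have h := inner_smul_conj Complex.I x x
  rw [real_inner_comm, Complex.conj_I, neg_smul, inner_neg_right] at h
  linarith

lemma grad_formula (f k : ℝ → ℝ) (k' b t : ℝ) (G : Esp n → ℝ) (x g : Esp n)
    (hf : HasDerivAt f (k (‖x‖^2) / 2) (‖x‖^2)) (hk : HasDerivAt k k' (‖x‖^2))
    (hG : HasGradientAt G g (rotE (k (‖x‖^2) * t) • x)) :
    HasGradientAt (fun x => f (‖x‖^2) + b * G (rotE (k (‖x‖^2) * t) • x))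
      (k (‖x‖^2) • x + b • ((starRingEnd ℂ (rotE (k (‖x‖^2) * t))) • g -
        (2 * t * k' * ⟪(starRingEnd ℂ (rotE (k (‖x‖^2) * t))) • g, Complex.I • x⟫) • x)) x := by
  rw [hasGradientAt_iff_hasFDerivAt] at hG ⊢
  have hn := (hasFDerivAt_id (𝕜 := ℝ) x).norm_sq
  have h1 : HasFDerivAt (fun x : Esp n => f (‖x‖^2)) _ x := hf.comp_hasFDerivAt x hn
  have h2 : HasFDerivAt (fun x : Esp n => k (‖x‖^2) * t) _ x :=
    (hk.comp_hasFDerivAt x hn).mul_const t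
  have h3 : HasFDerivAt (fun x : Esp n => rotE (k (‖x‖^2) * t)) _ x :=
    ((rotE_hasDerivAt _).hasFDerivAt).comp x h2
  have h4 : HasFDerivAt (fun x : Esp n => rotE (k (‖x‖^2) * t) • x) _ x :=
    h3.smul (hasFDerivAt_id (𝕜 := ℝ) x)
  have h45 : HasFDerivAt (fun x : Esp n => G (rotE (k (‖x‖^2) * t) • x)) _ x :=
    HasFDerivAt.comp (g := G) x hG h4
  have h5 := h1.add (h45.const_mul b)
  refine h5.congr_fderiv ?_
  ext ξ
  set e := rotE (k (‖x‖^2) * t)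
  have e1 : ∀ v : Esp n, ⟪(starRingEnd ℂ e) • g, v⟫ = ⟪g, e • v⟫ := by
    intro v; rw [inner_smul_conj, Complex.conj_conj]
  have e2 : ((t : ℂ) * ((k' : ℂ) * (2 * ((⟪x, ξ⟫ : ℝ) * (Complex.I * e))))) • x
      = (t * (k' * (2 * ⟪x, ξ⟫))) • (e • (Complex.I • x)) := by
    ext i
    simp
    ring
  simp [inner_add_left, inner_sub_left, real_inner_smul_left, inner_add_right, e1]
  rw [e2, real_inner_smul_right]
  ring

lemma orbit_formula (k : ℝ → ℝ) (k' b t : ℝ) (γ : ℝ → Esp n) (g : Esp n)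
    (hk : HasDerivAt k k' (‖γ t‖^2))
    (hγ : HasDerivAt γ (Complex.I • (k (‖γ t‖^2) • γ t + b • ((starRingEnd ℂ (rotE (k (‖γ t‖^2) * t))) • g -
        (2 * t * k' * ⟪(starRingEnd ℂ (rotE (k (‖γ t‖^2) * t))) • g, Complex.I • γ t⟫) • γ t))) t) :
    HasDerivAt (fun t => rotE (k (‖γ t‖^2) * t) • γ t) (b • (Complex.I • g)) t := by
  have hn := hγ.norm_sq
  have h2 : HasDerivAt (fun t => k (‖γ t‖^2) * t) _ t :=
    (hk.comp t hn).mul (hasDerivAt_id t)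
  have h3 : HasDerivAt (fun t => rotE (k (‖γ t‖^2) * t)) _ t :=
    (rotE_hasDerivAt _).scomp t h2
  have h4 : HasDerivAt (fun t => rotE (k (‖γ t‖^2) * t) • γ t) _ t := h3.smul hγ
  convert h4 using 1
  have hr := rotE_mul_conj (k (‖γ t‖^2) * t)
  set e := rotE (k (‖γ t‖^2) * t) with he
  set u : Esp n := (starRingEnd ℂ e) • g with hu
  have hg : g = e • u := by rw [hu, smul_smul, hr, one_smul]
  set K := k (‖γ t‖^2)
  set x := γ t
  have hi : ⟪x, Complex.I • (K • x + b • (u - (2 * t * k' * ⟪u, Complex.I • x⟫) • x))⟫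
      = - b * ⟪u, Complex.I • x⟫ := by
    have a1 : Complex.I • (K • x + b • (u - (2 * t * k' * ⟪u, Complex.I • x⟫) • x))
      = (K - b * (2 * t * k' * ⟪u, Complex.I • x⟫)) • (Complex.I • x) + b • (Complex.I • u) := by
      ext i
      simp
      ring
    have a2 : ⟪x, Complex.I • u⟫ = - ⟪u, Complex.I • x⟫ := by
      rw [real_inner_comm, inner_smul_conj, Complex.conj_I, neg_smul, inner_neg_right]
    rw [a1, inner_add_right, real_inner_smul_right, real_inner_smul_right, inner_I_self, a2]
    ring
  rw [hi, hg]
  ext i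
  simp
  ring

lemma exists_G (n : ℕ) (hn : 1 ≤ n) (ε δ : ℝ) (hε : 0 < ε) (hδ : 0 < δ) :
    ∃ G : Esp n → ℝ, ContDiff ℝ (⊤ : ℕ∞) G ∧ (∀ x, 0 ≤ G x) ∧ (∀ x, G x ≤ ε / 2) ∧
      (∀ x ∉ ball (0 : Esp n) δ, G x = 0) ∧
      (∀ x y, ‖gradient G x - gradient G y‖ ≤ (1/2) * ‖x - y‖) ∧ gradient G 0 ≠ 0 := by
  let φ : ContDiffBump (0 : Esp n) := ⟨δ/3, δ/2, by positivity, by linarith⟩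
  let e : Esp n := EuclideanSpace.single ⟨0, hn⟩ 1
  have he : ‖e‖ = 1 := by simp [e]
  let g : Esp n → ℝ := fun x => φ x * (δ + ⟪e, x⟫)
  have hzero : ∀ x ∉ ball (0 : Esp n) (δ/2), φ x = 0 := by
    intro x hx
    apply φ.zero_of_le_dist
    simpa using hx
  have habs : ∀ x ∈ ball (0 : Esp n) (δ/2), |⟪e, x⟫| ≤ δ := by
    intro x hx
    have := abs_real_inner_le_norm e x
    rw [he, one_mul] at this
    have h2 : ‖x‖ < δ/2 := by simpa using hx
    linarith
  have hg0 : ∀ x, 0 ≤ g x := by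
    intro x
    by_cases hx : x ∈ ball (0 : Esp n) (δ/2)
    · exact mul_nonneg φ.nonneg (by linarith [(abs_le.1 (habs x hx)).1])
    · simp [g, hzero x hx]
  have hg1 : ∀ x, g x ≤ 2 * δ := by
    intro x
    by_cases hx : x ∈ ball (0 : Esp n) (δ/2)
    · have h1 : φ x ≤ 1 := φ.le_one
      have h0 : 0 ≤ φ x := φ.nonneg
      have := abs_le.1 (habs x hx)
      show φ x * (δ + ⟪e, x⟫) ≤ 2 * δ
      nlinarith
    · simp [g, hzero x hx]; positivity
  have hgs : ContDiff ℝ (⊤ : ℕ∞) g :=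
    φ.contDiff.mul (contDiff_const.add (contDiff_const.inner ℝ contDiff_id))
  have hgc : HasCompactSupport g := φ.hasCompactSupport.mul_right
  have hfs : ContDiff ℝ 1 (fderiv ℝ g) := hgs.fderiv_right (by norm_cast)
  obtain ⟨L, hL⟩ := hfs.lipschitzWith_of_hasCompactSupport (hgc.fderiv (𝕜 := ℝ)) one_ne_zero
  let η : ℝ := min (1 / (2 * (L + 1))) (ε / (4 * δ))
  have hη : 0 < η := by
    have : (0:ℝ) ≤ L := L.2
    exact lt_min (by positivity) (by positivity)
  have hηL : η * L ≤ 1/2 := by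
    have h0 : (0:ℝ) ≤ L := L.2
    calc η * L ≤ (1 / (2 * ((L:ℝ) + 1))) * L := mul_le_mul_of_nonneg_right (min_le_left _ _) h0
      _ ≤ 1/2 := by
        rw [div_mul_eq_mul_div, div_le_div_iff₀ (by positivity) (by positivity)]; linarith
  have hηε : η * (2 * δ) ≤ ε / 2 := by
    calc η * (2 * δ) ≤ (ε / (4 * δ)) * (2 * δ) :=
          mul_le_mul_of_nonneg_right (min_le_right _ _) (by positivity)
      _ = ε/2 := by field_simp; ring
  have hgd : ∀ x, DifferentiableAt ℝ g x := fun x => (hgs.differentiable (by simp)) x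
  have hgrad : ∀ x, HasGradientAt (fun x => η * g x) (η • gradient g x) x := by
    intro x
    rw [hasGradientAt_iff_hasFDerivAt]
    have := ((hgd x).hasGradientAt.hasFDerivAt).const_mul η
    refine this.congr_fderiv ?_
    ext ξ
    simp [real_inner_smul_left]
  refine ⟨fun x => η * g x, contDiff_const.mul hgs, fun x => mul_nonneg hη.le (hg0 x), ?_, ?_, ?_, ?_⟩
  · intro x
    exact (mul_le_mul_of_nonneg_left (hg1 x) hη.le).trans hηε
  · intro x hx
    have : x ∉ ball (0 : Esp n) (δ/2) := fun h => hx (ball_subset_ball (by linarith) h)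
    simp [g, hzero x this]
  · intro x y
    rw [(hgrad x).gradient, (hgrad y).gradient, ← smul_sub, norm_smul, Real.norm_of_nonneg hη.le]
    have h1 : ‖gradient g x - gradient g y‖ ≤ L * ‖x - y‖ := by
      unfold gradient
      rw [← map_sub, LinearIsometryEquiv.norm_map]
      simpa [dist_eq_norm] using hL.dist_le_mul x y
    calc _ ≤ η * (L * ‖x - y‖) := mul_le_mul_of_nonneg_left h1 hη.le
      _ = (η * L) * ‖x - y‖ := by ring
      _ ≤ _ := mul_le_mul_of_nonneg_right hηL (norm_nonneg _)
  · rw [(hgrad 0).gradient]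
    have h1 : HasGradientAt g e 0 := by
      rw [hasGradientAt_iff_hasFDerivAt]
      have h2 : HasFDerivAt (fun x : Esp n => δ + ⟪e, x⟫) (InnerProductSpace.toDual ℝ (Esp n) e) 0 :=
        ((InnerProductSpace.toDual ℝ (Esp n) e).hasFDerivAt).const_add δ
      refine h2.congr_of_eventuallyEq ?_
      filter_upwards [φ.eventuallyEq_one] with x hx
      simp [g, hx]
    rw [h1.gradient]
    refine smul_ne_zero hη.ne' ?_
    intro h; rw [h] at he; simp at he

/-- The periodic cutoff in time. -/
def betaFn (t : ℝ) : ℝ := Real.smoothTransition (-Real.cos (2 * Real.pi * t))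

lemma beta_contDiff : ContDiff ℝ (⊤ : ℕ∞) betaFn := by
  unfold betaFn
  exact Real.smoothTransition.contDiff.comp
    ((Real.contDiff_cos.comp (contDiff_const.mul contDiff_id)).neg)

lemma beta_nonneg (t : ℝ) : 0 ≤ betaFn t := Real.smoothTransition.nonneg _

lemma beta_le_one (t : ℝ) : betaFn t ≤ 1 := Real.smoothTransition.le_one _

lemma beta_periodic (t : ℝ) : betaFn (t + 1) = betaFn t := by
  unfold betaFn
  rw [mul_add, mul_one, Real.cos_add_two_pi]

lemma beta_zero (t : ℝ) (h : 0 ≤ Real.cos (2 * Real.pi * t)) : betaFn t = 0 :=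
  Real.smoothTransition.zero_of_nonpos (by linarith)

lemma beta_one : betaFn 1 = 0 := beta_zero 1 (by simp)

lemma beta_int_pos : 0 < ∫ t in (0:ℝ)..1, betaFn t := by
  refine intervalIntegral.integral_pos one_pos beta_contDiff.continuous.continuousOn
    (fun x _ => beta_nonneg x) ⟨1/2, by constructor <;> norm_num, ?_⟩
  have : 2 * Real.pi * (1/2) = Real.pi := by ring
  unfold betaFn
  rw [this]
  simp

lemma H_contDiff (f k : ℝ → ℝ) (G : Esp n → ℝ) (hf : ContDiff ℝ (⊤ : ℕ∞) f)
    (hk : ContDiff ℝ (⊤ : ℕ∞) k) (hG : ContDiff ℝ (⊤ : ℕ∞) G) :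
    ContDiff ℝ (⊤ : ℕ∞) (fun p : ℝ × Esp n =>
      f (‖p.2‖^2) + betaFn p.1 * G (rotE (k (‖p.2‖^2) * Int.fract p.1) • p.2)) := by
  have hns : ContDiff ℝ (⊤ : ℕ∞) (fun p : ℝ × Esp n => ‖p.2‖^2) := contDiff_snd.norm_sq ℝ
  have hF : ContDiff ℝ (⊤ : ℕ∞) (fun p : ℝ × Esp n => f (‖p.2‖^2)) := hf.comp hns
  rw [contDiff_iff_contDiffAt]
  rintro ⟨t₀, x₀⟩
  by_cases hc : 0 < Real.cos (2 * Real.pi * t₀)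
  · refine hF.contDiffAt.congr_of_eventuallyEq ?_
    have hcont : ContinuousAt (fun p : ℝ × Esp n => Real.cos (2 * Real.pi * p.1)) (t₀, x₀) := by
      fun_prop
    filter_upwards [hcont.eventually (lt_mem_nhds hc)] with p hp
    rw [beta_zero p.1 hp.le]; simp
  · have hfr : 0 < Int.fract t₀ := by
      refine lt_of_le_of_ne (Int.fract_nonneg _) fun h => hc ?_
      have : t₀ = (⌊t₀⌋ : ℝ) := by have := Int.self_sub_floor t₀; linarith
      rw [this, mul_comm, Real.cos_int_mul_two_pi]; exact one_pos
    have hS : ContDiff ℝ (⊤ : ℕ∞) (fun p : ℝ × Esp n =>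
        f (‖p.2‖^2) + betaFn p.1 * G (rotE (k (‖p.2‖^2) * (p.1 - ⌊t₀⌋)) • p.2)) := by
      refine hF.add ((beta_contDiff.comp contDiff_fst).mul (hG.comp ?_))
      have h1 : ContDiff ℝ (⊤ : ℕ∞) (fun p : ℝ × Esp n => rotE (k (‖p.2‖^2) * (p.1 - ⌊t₀⌋))) :=
        rotE_contDiff.comp ((hk.comp hns).mul (contDiff_fst.sub contDiff_const))
      exact h1.smul contDiff_snd
    refine hS.contDiffAt.congr_of_eventuallyEq ?_
    have hcont : ContinuousAt (fun p : ℝ × Esp n => p.1) (t₀, x₀) := continuousAt_fst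
    have l1 : (⌊t₀⌋ : ℝ) < t₀ := by have := Int.self_sub_floor t₀; linarith
    filter_upwards [hcont.eventually (lt_mem_nhds l1), hcont.eventually (gt_mem_nhds (Int.lt_floor_add_one t₀))]
      with p hp1 hp2
    have : ⌊p.1⌋ = ⌊t₀⌋ := Int.floor_eq_iff.2 ⟨hp1.le, hp2⟩
    rw [← Int.self_sub_floor p.1, this]

/-- **Polterovich's example (Example 5.6 of Ginzburg–Gürel)**: for any
`ε, C, δ > 0` there is a smooth `1`-periodic-in-time, nonnegative Hamiltonian
`H` supported (in `x`, uniformly in `t`) in the ball of radius `δ`, with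
`H t 0 ≥ C` for all `t`, all of whose `1`-periodic orbits have action `< ε`. -/
theorem stmt_18 (n : ℕ) (hn : 1 ≤ n) (ε C δ : ℝ)
    (hε : 0 < ε) (hC : 0 < C) (hδ : 0 < δ) :
    ∃ H : ℝ → Esp n → ℝ,
      ContDiff ℝ (⊤ : ℕ∞) (fun p : ℝ × Esp n => H p.1 p.2) ∧
      (∀ t x, H (t + 1) x = H t x) ∧
      (∀ t x, 0 ≤ H t x) ∧
      (∀ t, ∀ x ∉ ball (0 : Esp n) δ, H t x = 0) ∧
      (∀ t, C ≤ H t 0) ∧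
      ∀ γ : ℝ → Esp n,
        (∀ t, HasDerivAt γ (Complex.I • gradient (H t) (γ t)) t) →
        (∀ t, γ (t + 1) = γ t) → action H γ < ε := by
  obtain ⟨G, hGs, hG0, hG1, hGsupp, hGL, hGne⟩ := exists_G n hn ε δ hε hδ
  set B := ∫ t in (0:ℝ)..1, betaFn t with hBdef
  have hB : 0 < B := beta_int_pos
  set a := ‖gradient G 0‖ with ha
  have ha0 : 0 < a := norm_pos_iff.2 hGne
  let r : ℝ := min (δ/2) (B * a / (B + 8))
  have hr : 0 < r := lt_min (by positivity) (by positivity)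
  have hrδ : r < δ := (min_le_left _ _).trans_lt (by linarith)
  have hrB : r * (B + 8) ≤ B * a := by
    have := min_le_right (δ/2) (B * a / (B + 8))
    rwa [le_div_iff₀ (by positivity)] at this
  let f : ℝ → ℝ := fun s => C * Real.smoothTransition (1 - s / r^2)
  let k : ℝ → ℝ := fun s => 2 * deriv f s
  have hfs : ContDiff ℝ (⊤ : ℕ∞) f :=
    contDiff_const.mul (Real.smoothTransition.contDiff.comp
      (contDiff_const.sub (contDiff_id.div_const _)))
  have hks : ContDiff ℝ (⊤ : ℕ∞) k := contDiff_const.mul (hfs.deriv' )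
  have hf0 : ∀ s, 0 ≤ f s := fun s => mul_nonneg hC.le (Real.smoothTransition.nonneg _)
  have hfz : ∀ s, r^2 ≤ s → f s = 0 := by
    intro s hs
    have : 1 ≤ s / r^2 := (one_le_div (by positivity)).2 hs
    simp only [f]
    rw [Real.smoothTransition.zero_of_nonpos (by linarith), mul_zero]
  have hkz : ∀ s, r^2 ≤ s → k s = 0 := by
    intro s hs
    have : IsLocalMin f s := Filter.Eventually.of_forall fun u => by rw [hfz s hs]; exact hf0 u
    simp [k, this.deriv_eq_zero]
  have hfd : ∀ s, HasDerivAt f (k s / 2) s := by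
    intro s
    have := (hfs.differentiable (by simp) s).hasDerivAt
    have e : k s / 2 = deriv f s := by
      show 2 * deriv f s / 2 = deriv f s
      ring
    rw [e]
    exact this
  have hkd : ∀ s, HasDerivAt k (deriv k s) s := fun s => (hks.differentiable (by simp) s).hasDerivAt
  have hGg : ∀ x, HasGradientAt G (gradient G x) x :=
    fun x => (hGs.differentiable (by simp) x).hasGradientAt
  have hnorm : ∀ (θ : ℝ) (x : Esp n), ‖rotE θ • x‖ = ‖x‖ := by
    intro θ x; rw [norm_smul, rotE_norm, one_mul]
  refine ⟨fun t x => f (‖x‖^2) + betaFn t * G (rotE (k (‖x‖^2) * Int.fract t) • x),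
    H_contDiff f k G hfs hks hGs, ?_, ?_, ?_, ?_, ?_⟩
  · intro t x
    simp only [beta_periodic, Int.fract_add_one]
  · intro t x
    exact add_nonneg (hf0 _) (mul_nonneg (beta_nonneg _) (hG0 _))
  · intro t x hx
    have hx' : δ ≤ ‖x‖ := by simpa using hx
    have h1 : f (‖x‖^2) = 0 := hfz _ (pow_le_pow_left₀ hr.le (hrδ.le.trans hx') 2)
    have h2 : G (rotE (k (‖x‖^2) * Int.fract t) • x) = 0 := by
      apply hGsupp
      simpa [hnorm] using hx'
    show f (‖x‖^2) + betaFn t * G (rotE (k (‖x‖^2) * Int.fract t) • x) = 0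
    rw [h1, h2, mul_zero, add_zero]
  · intro t
    have h1 : f (‖(0 : Esp n)‖^2) = C := by simp [f]
    have := mul_nonneg (beta_nonneg t) (hG0 (rotE (k (‖(0 : Esp n)‖^2) * Int.fract t) • (0 : Esp n)))
    show C ≤ f (‖(0 : Esp n)‖^2) + _
    rw [h1]
    linarith
  · intro γ hγ hper
    have hIn : ∀ v : Esp n, ‖Complex.I • v‖ = ‖v‖ := by intro v; simp [norm_smul]
    let y : ℝ → Esp n := fun t => rotE (k (‖γ t‖^2) * t) • γ t
    have hy : ∀ t ∈ Icc (0:ℝ) 1,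
        HasDerivAt y (betaFn t • (fun v => Complex.I • gradient G v) (y t)) t := by
      intro t ht
      have hfun : (fun x : Esp n => f (‖x‖^2) + betaFn t * G (rotE (k (‖x‖^2) * Int.fract t) • x))
          = fun x => f (‖x‖^2) + betaFn t * G (rotE (k (‖x‖^2) * t) • x) := by
        rcases ht.2.eq_or_lt with h | h
        · subst h; simp [beta_one]
        · rw [Int.fract_eq_self.2 ⟨ht.1, h⟩]
      have h1 := hγ t
      simp only at h1
      rw [hfun, (grad_formula f k (deriv k (‖γ t‖^2)) (betaFn t) t G (γ t) _ (hfd _) (hkd _)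
        (hGg _)).gradient] at h1
      exact orbit_formula k _ _ t γ _ (hkd _) h1
    have hmain := aux_main betaFn beta_contDiff.continuous beta_nonneg beta_le_one
      (fun v => Complex.I • gradient G v)
      (by intro u v; rw [← smul_sub, hIn]; exact hGL u v) y hy
    have hy0 : y 0 = γ 0 := by simp [y, rotE_zero]
    have hγ1 : γ 1 = γ 0 := by simpa using hper 0
    have hyn : ∀ t, ‖y t‖ = ‖γ t‖ := fun t => hnorm _ _
    have hge : r ≤ ‖γ 0‖ := by
      by_contra hlt
      push Not at hlt
      have h1 := hmain 0 (by simp)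
      simp only [hIn, hy0] at h1
      have h2 : ‖y 1 - γ 0‖ ≤ 2 * ‖γ 0‖ := by
        have := norm_sub_le (y 1) (γ 0)
        rw [hyn, hγ1] at this; linarith
      have h3 : a - 1/2 * r ≤ ‖gradient G (γ 0)‖ := by
        have e1 := hGL 0 (γ 0)
        have e2 := norm_sub_norm_le (gradient G 0) (gradient G (γ 0))
        rw [zero_sub, norm_neg] at e1
        linarith
      nlinarith
    have hy1 : y 1 = γ 0 := by
      simp only [y, hγ1]
      rw [hkz _ (pow_le_pow_left₀ hr.le hge 2), zero_mul, rotE_zero, one_smul]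
    have hgz : ∀ t ∈ Icc (0:ℝ) 1, gradient G (y t) = 0 := by
      intro t ht
      have h1 := hmain t ht
      simp only [hIn, hy0, hy1, sub_self, norm_zero] at h1
      rw [← norm_le_zero_iff]
      by_contra h
      push Not at h
      have : 0 < B / 2 * ‖gradient G (y t)‖ := by positivity
      linarith
    have hyc : ∀ t ∈ Icc (0:ℝ) 1, y t = γ 0 := by
      intro t ht
      have := (convex_Icc (0:ℝ) 1).norm_image_sub_le_of_norm_hasDerivWithin_le (f := y) (C := 0)
        (fun x hx => (hy x hx).hasDerivWithinAt) (fun x hx => by simp [hgz x hx])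
        (show (0:ℝ) ∈ Icc (0:ℝ) 1 by simp) ht
      rw [zero_mul, norm_le_zero_iff, sub_eq_zero] at this
      rw [this, hy0]
    have hγc : ∀ t ∈ Icc (0:ℝ) 1, γ t = γ 0 := by
      intro t ht
      have h1 : ‖γ t‖ = ‖γ 0‖ := by rw [← hyn, hyc t ht]
      have h2 := hyc t ht
      simp only [y] at h2
      rwa [h1, hkz _ (pow_le_pow_left₀ hr.le hge 2), zero_mul, rotE_zero, one_smul] at h2
    have hγall : γ = fun _ => γ 0 := by
      funext t
      have hp : Function.Periodic γ 1 := hper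
      have h1 : γ (t - ⌊t⌋ * 1) = γ t := hp.sub_int_mul_eq ⌊t⌋
      rw [← h1, mul_one, Int.self_sub_floor]
      exact hγc _ ⟨Int.fract_nonneg _, (Int.fract_lt_one _).le⟩
    have hd : ∀ t, deriv γ t = 0 := by intro t; rw [hγall]; simp
    unfold action
    simp only [hd, inner_zero_right, intervalIntegral.integral_zero, mul_zero, zero_add]
    have hb := intervalIntegral.norm_integral_le_of_norm_le_const (a := 0) (b := 1) (C := ε/2)
      (f := fun t => f (‖γ t‖^2) + betaFn t * G (rotE (k (‖γ t‖^2) * Int.fract t) • γ t)) (by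
        intro t _
        have e1 : γ t = γ 0 := congrFun hγall t
        rw [e1, hfz _ (pow_le_pow_left₀ hr.le hge 2), zero_add,
          Real.norm_of_nonneg (mul_nonneg (beta_nonneg _) (hG0 _))]
        have := hG1 (rotE (k (‖γ 0‖^2) * Int.fract t) • γ 0)
        nlinarith [beta_nonneg t, beta_le_one t, hG0 (rotE (k (‖γ 0‖^2) * Int.fract t) • γ 0)])
    have := (le_abs_self _).trans hb
    simp only [sub_zero, abs_one, mul_one] at this
    linarith
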